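/- Let n ≥ 1, k = 3, r = 2^n − 1, d = (2^{n+1} − 1)(2^n − 1)/3, s = 2^{n+1} − 1, and let A be the naive matrix of type (k,r). Then A(i,j) = 0 for all 1 ≤ i ≤ d and j > s, and A(i,j) = 0 for all i > d and 1 ≤ j ≤ s. -/

import Mathlib

/-- `A` is the *naive matrix* of type `(k, r)`: a `{0,1}`-matrix (here `Bool`-valued)
indexed by the positive integers, where `A i j = true` iff none of the following holds:
(i) there are `i' < i`, `j' < j` with `A i j' = A i' j = A i' j' = true`;
(ii) the `i`-th row already contains `k` ones before column `j`;
(iii) the `j`-th column already contains `r` ones before row `i`. -/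
def IsNaiveMatrix (k r : ℕ) (A : ℕ+ → ℕ+ → Bool) : Prop :=
  ∀ i j : ℕ+,
    A i j = true ↔
      ¬ ((∃ i' < i, ∃ j' < j, A i j' = true ∧ A i' j = true ∧ A i' j' = true) ∨
         k ≤ ((Finset.Ico 1 j).filter fun j' => A i j' = true).card ∨
         r ≤ ((Finset.Ico 1 i).filter fun i' => A i' j = true).card)

open Classical in
/-- The naive matrix with rows indexed from zero and columns from one, inside `ℕ`. -/
def NaiveN (r : ℕ) (B : ℕ → ℕ → Prop) : Prop :=
  ∀ i j : ℕ, B i j ↔ 0 < j ∧ ¬ ((∃ i' < i, ∃ j' < j, B i j' ∧ B i' j ∧ B i' j') ∨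
    3 ≤ ((Finset.range j).filter fun j' => B i j').card ∨
    r ≤ ((Finset.range i).filter fun i' => B i' j).card)

def UsedN (B : ℕ → ℕ → Prop) (i x y : ℕ) : Prop := ∃ i' < i, B i' x ∧ B i' y

def GoodN (N : ℕ) (B : ℕ → ℕ → Prop) (i : ℕ) : Prop :=
  ∃ a b, 0 < a ∧ a < b ∧ b < a ^^^ b ∧ a ^^^ b < N ∧ ∀ j, B i j ↔ j = a ∨ j = b ∨ j = a ^^^ b

theorem NaiveN.uniq {r : ℕ} {B : ℕ → ℕ → Prop} (h : NaiveN r B) {i1 i2 x y : ℕ} (hxy : x ≠ y)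
    (h1 : B i1 x) (h2 : B i1 y) (h3 : B i2 x) (h4 : B i2 y) : i1 = i2 := by
  wlog hlt : x < y generalizing x y
  · exact this hxy.symm h2 h1 h4 h3 (by omega)
  rcases lt_trichotomy i1 i2 with hh | hh | hh
  · exact absurd (Or.inl ⟨i1, hh, x, hlt, h3, h2, h1⟩) ((h i2 y).1 h4).2
  · exact hh
  · exact absurd (Or.inl ⟨i2, hh, x, hlt, h1, h4, h3⟩) ((h i1 y).1 h2).2

theorem GoodN.closed {N : ℕ} {B : ℕ → ℕ → Prop} {i x y : ℕ} (h : GoodN N B i) (hxy : x ≠ y)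
    (hx : B i x) (hy : B i y) : B i (x ^^^ y) := by
  obtain ⟨a, b, -, -, -, -, h⟩ := h
  rw [h] at hx hy ⊢
  have e1 : a ^^^ (a ^^^ b) = b := by simp
  have e2 : b ^^^ (a ^^^ b) = a := by rw [Nat.xor_comm a b]; simp
  have e3 : (a ^^^ b) ^^^ a = b := by rw [Nat.xor_comm]; exact e1
  have e4 : (a ^^^ b) ^^^ b = a := by rw [Nat.xor_comm]; exact e2
  have e5 : b ^^^ a = a ^^^ b := Nat.xor_comm _ _
  rcases hx with rfl | rfl | rfl <;> rcases hy with rfl | rfl | rfl <;> simp_all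

theorem GoodN.lt {N : ℕ} {B : ℕ → ℕ → Prop} {i x : ℕ} (h : GoodN N B i) 
    (hx : B i x) : 0 < x ∧ x < N := by
  obtain ⟨a, b, h1, h2, h3, h4, h⟩ := h
  rw [h] at hx
  omega

open Classical in
theorem GoodN.card {N : ℕ} {B : ℕ → ℕ → Prop} {i : ℕ} (h : GoodN N B i) :
    ((Finset.range N).filter fun j => B i j).card = 3 := by
  obtain ⟨a, b, h1, h2, h3, h4, h⟩ := h
  rw [Finset.card_eq_three]
  refine ⟨a, b, a ^^^ b, by omega, by omega, by omega, ?_⟩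
  ext j
  simp only [Finset.mem_filter, Finset.mem_range, h, Finset.mem_insert, Finset.mem_singleton]
  omega

theorem UsedN.symm {B : ℕ → ℕ → Prop} {i x y : ℕ} (h : UsedN B i x y) : UsedN B i y x := by
  obtain ⟨i', h1, h2, h3⟩ := h
  exact ⟨i', h1, h3, h2⟩

theorem UsedN.xor {N : ℕ} {B : ℕ → ℕ → Prop} {i x y : ℕ} (h : UsedN B i x y)
    (hG : ∀ i' < i, GoodN N B i') (hxy : x ≠ y) : UsedN B i x (x ^^^ y) := by
  obtain ⟨i', h1, h2, h3⟩ := h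
  exact ⟨i', h1, h2, (hG i' h1).closed hxy h2 h3⟩

open Classical in
theorem count_col {r N : ℕ} {B : ℕ → ℕ → Prop} (h : NaiveN r B) {i x : ℕ}
    (hG : ∀ i' < i, GoodN N B i') :
    2 * ((Finset.range i).filter fun i' => B i' x).card =
      ((Finset.range N).filter fun y => y ≠ x ∧ UsedN B i x y).card := by
  have e : ((Finset.range N).filter fun y => y ≠ x ∧ UsedN B i x y) =
      ((Finset.range i).filter fun i' => B i' x).biUnion
        (fun i' => ((Finset.range N).filter fun j => B i' j).erase x) := by
    ext y
    simp only [Finset.mem_filter, Finset.mem_range, Finset.mem_biUnion, Finset.mem_erase]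
    constructor
    · rintro ⟨h1, h2, i', h3, h4, h5⟩
      exact ⟨i', ⟨h3, h4⟩, h2, h1, h5⟩
    · rintro ⟨i', ⟨h3, h4⟩, h2, h1, h5⟩
      exact ⟨h1, h2, i', h3, h4, h5⟩
  rw [e, Finset.card_biUnion]
  · rw [Finset.sum_congr rfl (g := fun _ => 2), Finset.sum_const, smul_eq_mul, mul_comm]
    intro i' hi'
    simp only [Finset.mem_filter, Finset.mem_range] at hi'
    have hg := hG i' hi'.1
    rw [Finset.card_erase_of_mem, hg.card]
    simp only [Finset.mem_filter, Finset.mem_range]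
    exact ⟨(hg.lt hi'.2).2, hi'.2⟩
  · intro i1 h1 i2 h2 hne
    replace h1 := Finset.mem_filter.1 h1
    replace h2 := Finset.mem_filter.1 h2
    rw [Function.onFun, Finset.disjoint_left]
    intro y hy1 hy2
    simp only [Finset.mem_filter, Finset.mem_range, Finset.mem_erase] at hy1 hy2
    exact hne (h.uniq hy1.1 hy1.2.2 h1.2 hy2.2.2 h2.2)

open Classical in
theorem count_total {N : ℕ} {B : ℕ → ℕ → Prop} {i : ℕ}
    (hG : ∀ i' < i, GoodN N B i') :
    ∑ x ∈ Finset.range N, ((Finset.range i).filter fun i' => B i' x).card = 3 * i := by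
  simp only [Finset.card_filter]
  rw [Finset.sum_comm, Finset.sum_congr rfl (g := fun _ => 3)]
  · simp [mul_comm]
  · intro i' hi'
    rw [← Finset.card_filter]
    exact (hG i' (Finset.mem_range.1 hi')).card

theorem card_punct {N x : ℕ} (hx : 0 < x) (hxN : x < N) :
    (((Finset.range N).erase 0).erase x).card = N - 2 := by
  rw [Finset.card_erase_of_mem, Finset.card_erase_of_mem, Finset.card_range]
  · omega
  · simp; omega
  · simp; omega

open Classical in
theorem used_sub {N : ℕ} {B : ℕ → ℕ → Prop} {i x : ℕ}
    (hG : ∀ i' < i, GoodN N B i') :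
    ((Finset.range N).filter fun y => y ≠ x ∧ UsedN B i x y) ⊆ ((Finset.range N).erase 0).erase x := by
  intro y
  simp only [Finset.mem_filter, Finset.mem_range, Finset.mem_erase]
  rintro ⟨h1, h2, i', h3, h4, h5⟩
  have := (hG i' h3).lt h5
  omega

open Classical in
theorem col_full {r N : ℕ} {B : ℕ → ℕ → Prop} (h : NaiveN r B) {i x : ℕ} (hN : N = 2 * r + 2)
    (hG : ∀ i' < i, GoodN N B i') (hx : 0 < x) (hxN : x < N)
    (hu : ∀ y, 0 < y → y < N → y ≠ x → UsedN B i x y) :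
    ((Finset.range i).filter fun i' => B i' x).card = r := by
  have h1 := count_col h (x := x) hG
  have e : ((Finset.range N).filter fun y => y ≠ x ∧ UsedN B i x y) =
      ((Finset.range N).erase 0).erase x := by
    apply subset_antisymm (used_sub hG)
    intro y
    simp only [Finset.mem_filter, Finset.mem_range, Finset.mem_erase]
    rintro ⟨h1, h2, h3⟩
    exact ⟨h3, h1, hu y (by omega) h3 h1⟩
  rw [e, card_punct hx hxN] at h1
  omega

open Classical in
theorem col_le {r N : ℕ} {B : ℕ → ℕ → Prop} (h : NaiveN r B) {i x : ℕ} (hN : N = 2 * r + 2)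
    (hG : ∀ i' < i, GoodN N B i') (hx : 0 < x) (hxN : x < N) :
    ((Finset.range i).filter fun i' => B i' x).card ≤ r := by
  have h1 := count_col h (x := x) hG
  have := Finset.card_le_card (used_sub (x := x) hG)
  rw [card_punct hx hxN] at this
  omega

open Classical in
theorem col_lt {r N : ℕ} {B : ℕ → ℕ → Prop} (h : NaiveN r B) {i x y : ℕ} (hN : N = 2 * r + 2)
    (hG : ∀ i' < i, GoodN N B i') (hx : 0 < x) (hxN : x < N)
    (hy : 0 < y) (hyN : y < N) (hxy : y ≠ x) (hu : ¬ UsedN B i x y) :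
    ((Finset.range i).filter fun i' => B i' x).card < r := by
  have h1 := count_col h (x := x) hG
  have h2 : ((Finset.range N).filter fun y => y ≠ x ∧ UsedN B i x y) ⊂
      ((Finset.range N).erase 0).erase x := by
    rw [Finset.ssubset_iff_of_subset (used_sub hG)]
    refine ⟨y, ?_, ?_⟩
    · simp; omega
    · simp [hu]
  have := Finset.card_lt_card h2
  rw [card_punct hx hxN] at this
  omega

open Classical in
theorem good_step {r m N : ℕ} {B : ℕ → ℕ → Prop} (h : NaiveN r B) {i : ℕ} (hN : N = 2 * r + 2)
    (hm : N = 2 ^ m)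
    (hG : ∀ i' < i, GoodN N B i')
    (hex : ∃ a b, 0 < a ∧ a < N ∧ 0 < b ∧ b < N ∧ b ≠ a ∧ ¬ UsedN B i a b) : GoodN N B i := by
  obtain ⟨a, hb, hamin⟩ : ∃ a, (∃ b, 0 < a ∧ a < N ∧ 0 < b ∧ b < N ∧ b ≠ a ∧ ¬ UsedN B i a b) ∧
      ∀ a' < a, ¬ (∃ b, 0 < a' ∧ a' < N ∧ 0 < b ∧ b < N ∧ b ≠ a' ∧ ¬ UsedN B i a' b) :=
    ⟨Nat.find hex, Nat.find_spec hex, fun a' h' => Nat.find_min hex h'⟩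
  obtain ⟨b, ⟨ha0, haN, hb0, hbN, hba, hun⟩, hbmin⟩ :
      ∃ b, (0 < a ∧ a < N ∧ 0 < b ∧ b < N ∧ b ≠ a ∧ ¬ UsedN B i a b) ∧
      ∀ b' < b, ¬ (0 < a ∧ a < N ∧ 0 < b' ∧ b' < N ∧ b' ≠ a ∧ ¬ UsedN B i a b') :=
    ⟨Nat.find hb, Nat.find_spec hb, fun a' h' => Nat.find_min hb h'⟩
  have hA : ∀ x y, 0 < x → x < a → 0 < y → y < N → y ≠ x → UsedN B i x y := by
    intro x y h1 h2 h3 h4 h5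
    by_contra h6
    exact hamin x h2 ⟨y, h1, by omega, h3, h4, h5, h6⟩
  have hB : ∀ y, 0 < y → y < b → y ≠ a → UsedN B i a y := by
    intro y h1 h2 h3
    by_contra h6
    exact hbmin y h2 ⟨ha0, haN, h1, by omega, h3, h6⟩
  have hab : a < b := by
    by_contra hc
    exact hun (hA b a hb0 (by omega) ha0 haN (Ne.symm hba)).symm
  obtain ⟨c, hc⟩ : ∃ c, c = a ^^^ b := ⟨_, rfl⟩
  have hcN : c < N := by rw [hc, hm]; exact Nat.xor_lt_two_pow (hm ▸ haN) (hm ▸ hbN)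
  have hc0 : c ≠ 0 := by rw [hc]; simpa using hab.ne
  have hca : c ≠ a := by
    intro hh; rw [hh] at hc
    have : a ^^^ a = a ^^^ (a ^^^ b) := by rw [← hc]
    simp at this; omega
  have hcb : c ≠ b := by
    intro hh; rw [hh] at hc
    have : b ^^^ b = (a ^^^ b) ^^^ b := by rw [← hc]
    rw [Nat.xor_assoc] at this
    simp at this; omega
  have e1 : a ^^^ c = b := by rw [hc]; simp
  have e2 : b ^^^ c = a := by rw [hc, Nat.xor_comm a b]; simp
  have hunc : ¬ UsedN B i a c := by
    intro hh
    have := hh.xor hG hca.symm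
    rw [e1] at this
    exact hun this
  have hunbc : ¬ UsedN B i b c := by
    intro hh
    have := hh.xor hG hcb.symm
    rw [e2] at this
    exact hun this.symm
  have hbc : b < c := by
    by_contra hcc
    exact hunc (hB c (by omega) (by omega) hca)
  -- row entries
  have r1 : ∀ j < a, ¬ B i j := by
    intro j hj hBj
    have h1 := (h i j).1 hBj
    have := col_full h hN hG h1.1 (by omega) (fun y h2 h3 h4 => hA j y h1.1 hj h2 h3 h4)
    exact h1.2 (Or.inr (Or.inr this.ge))
  have cardle : ∀ (j : ℕ) (S : Finset ℕ), S.card ≤ 2 → (∀ x < j, B i x → x ∈ S) →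
      ¬ 3 ≤ ((Finset.range j).filter fun j' => B i j').card := by
    intro j S hS hsub
    have : ((Finset.range j).filter fun j' => B i j') ⊆ S := by
      intro x hx
      simp only [Finset.mem_filter, Finset.mem_range] at hx
      exact hsub x hx.1 hx.2
    have := Finset.card_le_card this
    omega
  have r2 : B i a := by
    rw [h]
    refine ⟨ha0, ?_⟩
    rintro (⟨i', hi', j', hj', h1, h2, h3⟩ | h1 | h1)
    · exact r1 j' hj' h1
    · exact cardle a ∅ (by simp) (fun x hx hb => absurd hb (r1 x hx)) h1
    · have := col_lt h hN hG ha0 haN hb0 hbN hba hun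
      omega
  have blk : ∀ x j, x < j → B i x → UsedN B i x j → ¬ B i j := by
    rintro x j hxj hx ⟨i', h1, h2, h3⟩ hj
    exact ((h i j).1 hj).2 (Or.inl ⟨i', h1, x, hxj, hx, h3, h2⟩)
  have r3 : ∀ j, a < j → j < b → ¬ B i j := fun j h1 h2 =>
    blk a j h1 r2 (hB j (by omega) h2 (by omega))
  have lowb : ∀ x < b, B i x → x = a := by
    intro x hx hBx
    by_contra hne
    rcases lt_or_gt_of_ne hne with h1 | h1
    · exact r1 x h1 hBx
    · exact r3 x h1 hx hBx
  have r4 : B i b := by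
    rw [h]
    refine ⟨hb0, ?_⟩
    rintro (⟨i', hi', j', hj', h1, h2, h3⟩ | h1 | h1)
    · rw [lowb j' hj' h1] at h3
      exact hun ⟨i', hi', h3, h2⟩
    · exact cardle b {a} (by simp) (fun x hx hb => by simp [lowb x hx hb]) h1
    · have := col_lt h hN hG hb0 hbN ha0 haN hba.symm (fun hh => hun hh.symm)
      omega
  have r5 : ∀ j, b < j → j < c → ¬ B i j := by
    intro j h1 h2
    have hjc := h2
    rw [hc] at h2
    rcases Nat.lt_xor_cases h2 with h3 | h3
    · have h4 : j ^^^ b ≠ 0 := by simpa using h1.ne'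
      have h5 := (hA (j ^^^ b) b (by omega) h3 hb0 hbN (by omega)).symm.xor hG (by omega)
      rw [Nat.xor_comm j b] at h5
      rw [← Nat.xor_assoc, Nat.xor_self, Nat.zero_xor] at h5
      exact blk b j h1 r4 h5
    · have h4 : j ^^^ a ≠ 0 := by simpa using (hab.trans h1).ne'
      have h6 : j ^^^ a ≠ a := by
        intro hh
        have : (j ^^^ a) ^^^ a = a ^^^ a := by rw [hh]
        rw [Nat.xor_assoc] at this
        simp at this; omega
      have h5 := (hB (j ^^^ a) (by omega) h3 h6).xor hG h6.symm
      rw [Nat.xor_comm j a] at h5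
      rw [← Nat.xor_assoc, Nat.xor_self, Nat.zero_xor] at h5
      exact blk a j (hab.trans h1) r2 h5
  have lowc : ∀ x < c, B i x → x = a ∨ x = b := by
    intro x hx hBx
    rcases lt_trichotomy x b with h1 | h1 | h1
    · exact Or.inl (lowb x h1 hBx)
    · exact Or.inr h1
    · exact absurd hBx (r5 x h1 hx)
  have r6 : B i c := by
    rw [h]
    refine ⟨by omega, ?_⟩
    rintro (⟨i', hi', j', hj', h1, h2, h3⟩ | h1 | h1)
    · rcases lowc j' hj' h1 with rfl | rfl
      · exact hunc ⟨i', hi', h3, h2⟩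
      · exact hunbc ⟨i', hi', h3, h2⟩
    · exact cardle c {a, b} Finset.card_le_two (fun x hx hb => by simp [lowc x hx hb]) h1
    · have := col_lt h hN hG (by omega) hcN ha0 haN hca.symm (fun hh => hunc hh.symm)
      omega
  have r7 : ∀ j, c < j → ¬ B i j := by
    intro j hj hBj
    refine ((h i j).1 hBj).2 (Or.inr (Or.inl ?_))
    have h3 : ({a, b, c} : Finset ℕ).card = 3 :=
      Finset.card_eq_three.2 ⟨a, b, c, by omega, by omega, by omega, rfl⟩
    rw [← h3]
    apply Finset.card_le_card
    intro x hx
    simp only [Finset.mem_insert, Finset.mem_singleton] at hx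
    simp only [Finset.mem_filter, Finset.mem_range]
    rcases hx with rfl | rfl | rfl
    · exact ⟨by omega, r2⟩
    · exact ⟨by omega, r4⟩
    · exact ⟨by omega, r6⟩
  refine ⟨a, b, ha0, hab, hc ▸ hbc, hc ▸ hcN, ?_⟩
  intro j
  rw [← hc]
  constructor
  · intro hj
    rcases lt_trichotomy j c with h1 | h1 | h1
    · rcases lowc j h1 hj with h2 | h2 <;> simp [h2]
    · simp [h1]
    · exact absurd hj (r7 j h1)
  · rintro (rfl | rfl | rfl) <;> assumption

open Classical in
theorem total_split {N : ℕ} {r : ℕ} {B : ℕ → ℕ → Prop} (h : NaiveN r B) {i : ℕ} 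
    (hG : ∀ i' < i, GoodN N B i') :
    ∑ x ∈ (Finset.range N).erase 0, ((Finset.range i).filter fun i' => B i' x).card = 3 * i := by
  rw [← count_total hG, Finset.sum_erase]
  rw [Finset.card_eq_zero, Finset.filter_eq_empty_iff]
  intro x _ hx
  exact absurd ((h x 0).1 hx).1 (by omega)

theorem good_all {r m N d : ℕ} {B : ℕ → ℕ → Prop} (h : NaiveN r B) (hN : N = 2 * r + 2)
    (hm : N = 2 ^ m) (hd : 3 * d = (N - 1) * r) : ∀ i < d, GoodN N B i := by
  classical
  intro i
  induction i using Nat.strong_induction_on with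
  | _ i ih =>
  intro hi
  have hG : ∀ i' < i, GoodN N B i' := fun i' h' => ih i' h' (by omega)
  apply good_step h hN hm hG
  by_contra hne
  have ht := total_split h hG
  rw [Finset.sum_congr rfl (g := fun _ => r)] at ht
  · rw [Finset.sum_const, Finset.card_erase_of_mem (by simp; omega), Finset.card_range,
      smul_eq_mul] at ht
    omega
  · intro x hx
    simp only [Finset.mem_erase, Finset.mem_range] at hx
    apply col_full h hN hG (by omega) hx.2
    intro y h1 h2 h3
    by_contra h4
    exact hne ⟨x, y, by omega, hx.2, h1, h2, h3, h4⟩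

theorem after_zero {r m N d : ℕ} {B : ℕ → ℕ → Prop} (h : NaiveN r B) (hN : N = 2 * r + 2)
    (hm : N = 2 ^ m) (hd : 3 * d = (N - 1) * r) (i j : ℕ) (hi : d ≤ i) (hj : j < N) :
    ¬ B i j := by
  classical
  intro hB
  have hG := good_all h hN hm hd
  have ht := total_split h hG
  have h1 := (h i j).1 hB
  have hc : ((N - 1) * r) = ∑ x ∈ (Finset.range N).erase 0, r := by
    rw [Finset.sum_const, Finset.card_erase_of_mem (by simp; omega), Finset.card_range,
      smul_eq_mul]
  rw [hd, hc, Finset.sum_eq_sum_iff_of_le] at ht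
  · have h2 := ht j (by simp; omega)
    refine h1.2 (Or.inr (Or.inr ?_))
    rw [← h2]
    apply Finset.card_le_card
    apply Finset.filter_subset_filter
    intro x; simp; omega
  · intro x hx
    simp only [Finset.mem_erase, Finset.mem_range] at hx
    exact col_le h hN hG (by omega) hx.2

/-- Transfer to natural-number indices. -/
def toN (A : ℕ+ → ℕ+ → Bool) (i j : ℕ) : Prop := 0 < j ∧ A i.succPNat j.toPNat' = true

theorem toN_iff (A : ℕ+ → ℕ+ → Bool) (i : ℕ) (j : ℕ+) :
    toN A i j ↔ A i.succPNat j = true := by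
  simp [toN]

theorem toN_naive {r : ℕ} {A : ℕ+ → ℕ+ → Bool} (hA : IsNaiveMatrix 3 r A) :
    NaiveN r (toN A) := by
  classical
  intro i j
  rcases Nat.eq_zero_or_pos j with rfl | hj
  · simp [toN]
  obtain ⟨j, rfl⟩ : ∃ j' : ℕ+, (j' : ℕ) = j := ⟨⟨j, hj⟩, rfl⟩
  rw [toN_iff, hA]
  simp only [hj, true_and]
  have ex : (∃ i' < i.succPNat, ∃ j' < j, A i.succPNat j' = true ∧ A i' j = true ∧ A i' j' = true) ↔
      (∃ i' < i, ∃ j' < (j : ℕ), toN A i j' ∧ toN A i' j ∧ toN A i' j') := by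
    constructor
    · rintro ⟨i', h1, j', h2, h3, h4, h5⟩
      have e : (i'.natPred).succPNat = i' := PNat.succPNat_natPred i'
      refine ⟨i'.natPred, ?_, j', h2, ?_⟩
      · rw [← e] at h1
        exact Nat.succPNat_lt_succPNat.1 h1
      · simp only [toN_iff, e]
        exact ⟨h3, h4, h5⟩
    · rintro ⟨i', h1, j', h2, h3, h4, h5⟩
      obtain ⟨j', rfl⟩ : ∃ j'' : ℕ+, (j'' : ℕ) = j' := ⟨⟨j', h3.1⟩, rfl⟩
      simp only [toN_iff] at h3 h4 h5
      exact ⟨i'.succPNat, Nat.succPNat_lt_succPNat.2 h1, j', h2, h3, h4, h5⟩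
  have c1 : ((Finset.Ico 1 j).filter fun j' => A i.succPNat j' = true).card =
      ((Finset.range j).filter fun j' => toN A i j').card := by
    apply Finset.card_bij (fun (x : ℕ+) _ => (x : ℕ))
    · intro x hx
      simp only [Finset.mem_filter, Finset.mem_Ico, Finset.mem_range, toN_iff] at hx ⊢
      exact ⟨hx.1.2, hx.2⟩
    · intro x _ y _ hxy
      exact PNat.coe_injective hxy
    · intro x hx
      simp only [Finset.mem_filter, Finset.mem_range] at hx
      obtain ⟨x, rfl⟩ : ∃ j'' : ℕ+, (j'' : ℕ) = x := ⟨⟨x, hx.2.1⟩, rfl⟩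
      refine ⟨x, ?_, rfl⟩
      simp only [toN_iff] at hx
      simp only [Finset.mem_filter, Finset.mem_Ico]
      exact ⟨⟨PNat.one_le x, hx.1⟩, hx.2⟩
  have c2 : ((Finset.Ico 1 i.succPNat).filter fun i' => A i' j = true).card =
      ((Finset.range i).filter fun i' => toN A i' j).card := by
    symm
    apply Finset.card_bij (fun (x : ℕ) _ => x.succPNat)
    · intro x hx
      simp only [Finset.mem_filter, Finset.mem_Ico, Finset.mem_range, toN_iff] at hx ⊢
      exact ⟨⟨PNat.one_le _, Nat.succPNat_lt_succPNat.2 hx.1⟩, hx.2⟩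
    · intro x _ y _ hxy
      exact Nat.succPNat_injective hxy
    · intro x hx
      simp only [Finset.mem_filter, Finset.mem_Ico] at hx
      have e : (x.natPred).succPNat = x := PNat.succPNat_natPred x
      refine ⟨x.natPred, ?_, e⟩
      simp only [Finset.mem_filter, Finset.mem_range, toN_iff, e]
      refine ⟨?_, hx.2⟩
      have h1 := hx.1.2
      rw [← e] at h1
      exact Nat.succPNat_lt_succPNat.1 h1
  rw [ex, c1, c2]

/-- For `k = 3`, `r = 2 ^ n - 1` (`n ≥ 1`), `d = (2 ^ (n+1) - 1) * (2 ^ n - 1) / 3` and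
`s = 2 ^ (n+1) - 1`, the naive matrix `A` of type `(k, r)` vanishes on the first `d`
rows beyond column `s`, and on the first `s` columns beyond row `d`. -/
theorem naive_matrix_block_zero (n : ℕ) (hn : 1 ≤ n)
    (A : ℕ+ → ℕ+ → Bool) (hA : IsNaiveMatrix 3 (2 ^ n - 1) A)
    (d s : ℕ) (hd : d = (2 ^ (n + 1) - 1) * (2 ^ n - 1) / 3) (hs : s = 2 ^ (n + 1) - 1) :
    (∀ i j : ℕ+, (i : ℕ) ≤ d → s < (j : ℕ) → A i j = false) ∧
    (∀ i j : ℕ+, d < (i : ℕ) → (j : ℕ) ≤ s → A i j = false) := by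
  have h := toN_naive hA
  have hpos : 0 < 2 ^ n := by positivity
  have hN : 2 ^ (n + 1) = 2 * (2 ^ n - 1) + 2 := by rw [pow_succ]; omega
  have hdvd : 3 ∣ (2 ^ (n + 1) - 1) * (2 ^ n - 1) := by
    have h3 : 2 ^ n % 3 = 1 ∨ 2 ^ n % 3 = 2 := by
      clear hN hd hs hA h hpos hn
      induction n with
      | zero => simp
      | succ k ih => rw [pow_succ]; omega
    rcases h3 with h3 | h3
    · exact Dvd.dvd.mul_left (by omega) _
    · exact Dvd.dvd.mul_right (by omega) _
  have hd3 : 3 * d = (2 ^ (n + 1) - 1) * (2 ^ n - 1) := by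
    rw [hd]; exact Nat.mul_div_cancel' hdvd
  have key : ∀ i j : ℕ+, A i j = true ↔ toN A i.natPred j := by
    intro i j
    rw [toN_iff, PNat.succPNat_natPred]
  constructor
  · intro i j hi hj
    rw [Bool.eq_false_iff, Ne, key]
    intro hB
    have hi' : i.natPred < d := by
      have := i.pos
      rw [PNat.natPred]; omega
    have := ((good_all h hN rfl hd3 _ hi').lt hB).2
    omega
  · intro i j hi hj
    rw [Bool.eq_false_iff, Ne, key]
    apply after_zero h hN rfl hd3
    · rw [PNat.natPred]; omega
    · omega
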